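/- Let n ≥ 2 be an integer, and let ω, α₁, α₂ be nonzero complex constants with α₁ ≠ α₂, α₁ ≠ nα₂ and α₂ ≠ nα₁. Let γ₁, γ₂, m₁, m₂ be complex numbers. If (γ₁e^{α₁z} + γ₂e^{α₂z})^n + ω(γ₁e^{α₁z} + γ₂e^{α₂z})^{n−1}(α₁γ₁e^{α₁z} + α₂γ₂e^{α₂z}) = m₁e^{α₁z} + m₂e^{α₂z} holds for all z ∈ ℂ, then γ₁ = 0 or γ₂ = 0. -/

import Mathlib

open Complex Filter Metric Polynomial

noncomputable section

/-- The functions `z ↦ exp (b * z)`, for `b : ℂ`, are linearly independent. -/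
theorem linearIndependent_exp_mul :
    LinearIndependent ℂ (fun b z : ℂ => Complex.exp (b * z)) := by
  let φ : ℂ → (Multiplicative ℂ →* ℂ) := fun b =>
    { toFun := fun z => Complex.exp (b * z.toAdd)
      map_one' := by simp
      map_mul' := fun x y => by simp [mul_add, Complex.exp_add] }
  have hφ : Function.Injective φ := by
    intro a b hab
    have hfun : (fun z : ℂ => Complex.exp (a * z)) = fun z => Complex.exp (b * z) :=
      funext fun z => DFunLike.congr_fun hab (Multiplicative.ofAdd z)
    have hderiv (c : ℂ) : deriv (fun z : ℂ => Complex.exp (c * z)) 0 = c := by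
      simpa using (((hasDerivAt_id (0 : ℂ)).const_mul c).cexp).deriv
    rw [← hderiv a, hfun, hderiv b]
  exact (linearIndependent_monoidHom (Multiplicative ℂ) ℂ).comp φ hφ

/-- If a polynomial in `exp (d * z)`, with `d ≠ 0`, is a combination of two exponentials with
nonzero frequencies, then its constant coefficient vanishes. -/
theorem coeff_zero_eq_zero_of_eval_exp_eq (P : ℂ[X]) {d b₁ b₂ m₁ m₂ : ℂ}
    (hd : d ≠ 0) (hb₁ : b₁ ≠ 0) (hb₂ : b₂ ≠ 0)
    (h : ∀ z : ℂ, P.eval (Complex.exp (d * z))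
      = m₁ * Complex.exp (b₁ * z) + m₂ * Complex.exp (b₂ * z)) :
    P.coeff 0 = 0 := by
  let v : ℂ →₀ ℂ := ∑ k ∈ Finset.range (P.natDegree + 1), Finsupp.single (k * d) (P.coeff k)
    - (Finsupp.single b₁ m₁ + Finsupp.single b₂ m₂)
  have hv : v = 0 := by
    refine linearIndependent_iff.mp linearIndependent_exp_mul v ?_
    funext z
    have hz := h z
    rw [Polynomial.eval_eq_sum_range] at hz
    simp only [v, map_sub, map_add, map_sum, Finsupp.linearCombination_single, Pi.sub_apply,
      Pi.add_apply, Finset.sum_apply, Pi.smul_apply, smul_eq_mul, Pi.zero_apply]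
    rw [← hz, sub_eq_zero]
    refine Finset.sum_congr rfl fun k _ => ?_
    rw [← Complex.exp_nat_mul, mul_assoc]
  have h0 := DFunLike.congr_fun hv 0
  simpa [v, Finsupp.single_apply, Finsupp.finsetSum_apply, hd, hb₁, hb₂] using h0

/-- Comparison of the coefficients of `exp (n * α₁ * z)` in
`f ^ n + ω * f ^ (n - 1) * f' = m₁ * exp (α₁ * z) + m₂ * exp (α₂ * z)`, where
`f = γ₁ * exp (α₁ * z) + γ₂ * exp (α₂ * z)`. -/
theorem eq_zero_or_one_add_mul_eq_zero {n : ℕ} (hn : 2 ≤ n)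
    {ω α₁ α₂ : ℂ} (hα₁ : α₁ ≠ 0) (hα : α₁ ≠ α₂) (hr : α₂ ≠ (n : ℂ) * α₁)
    {γ₁ γ₂ m₁ m₂ : ℂ}
    (heq : ∀ z : ℂ,
      (γ₁ * Complex.exp (α₁ * z) + γ₂ * Complex.exp (α₂ * z)) ^ n
        + ω * (γ₁ * Complex.exp (α₁ * z) + γ₂ * Complex.exp (α₂ * z)) ^ (n - 1)
          * (α₁ * γ₁ * Complex.exp (α₁ * z) + α₂ * γ₂ * Complex.exp (α₂ * z))
        = m₁ * Complex.exp (α₁ * z) + m₂ * Complex.exp (α₂ * z)) :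
    γ₁ = 0 ∨ 1 + ω * α₁ = 0 := by
  obtain ⟨N, rfl⟩ : ∃ N, n = N + 1 := ⟨n - 1, by omega⟩
  let P : ℂ[X] := (C γ₁ + C γ₂ * X) ^ N
    * (C (γ₁ * (1 + ω * α₁)) + C (γ₂ * (1 + ω * α₂)) * X)
  have hb₁ : α₁ - (N + 1 : ℕ) * α₁ ≠ 0 := by
    have hN : (N : ℂ) ≠ 0 := Nat.cast_ne_zero.mpr (by omega)
    have : α₁ - (N + 1 : ℕ) * α₁ = -(N * α₁) := by push_cast; ring
    rw [this]
    exact neg_ne_zero.mpr (mul_ne_zero hN hα₁)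
  have hP : P.coeff 0 = 0 := by
    refine coeff_zero_eq_zero_of_eval_exp_eq P (m₁ := m₁) (m₂ := m₂)
      (sub_ne_zero.mpr hα.symm) hb₁ (sub_ne_zero.mpr hr) fun z => ?_
    have hz := heq z
    have hE : Complex.exp (α₁ * z) ≠ 0 := Complex.exp_ne_zero _
    simp only [P, sub_mul, Complex.exp_sub, mul_assoc, Complex.exp_nat_mul, eval_mul, eval_pow,
      eval_add, eval_C, eval_X, Nat.add_sub_cancel] at hz ⊢
    generalize Complex.exp (α₁ * z) = x at *
    generalize Complex.exp (α₂ * z) = y at *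
    have hf : γ₁ + γ₂ * (y / x) = (γ₁ * x + γ₂ * y) / x := by field_simp
    have hm : m₁ * (x / x ^ (N + 1)) + m₂ * (y / x ^ (N + 1))
        = (m₁ * x + m₂ * y) / x ^ (N + 1) := by
      ring
    rw [hf, div_pow, hm, ← hz]
    field_simp
    ring
  rw [Polynomial.coeff_zero_eq_eval_zero] at hP
  simp only [P, eval_mul, eval_pow, eval_add, eval_C, eval_X, mul_zero, add_zero] at hP
  rcases mul_eq_zero.mp hP with h | h
  · exact .inl (eq_zero_of_pow_eq_zero h)
  · exact mul_eq_zero.mp h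

/-- If `f = γ₁ e^{α₁ z} + γ₂ e^{α₂ z}` satisfies
`f^n + ω f^{n-1} f' = m₁ e^{α₁ z} + m₂ e^{α₂ z}`, then `γ₁ = 0` or `γ₂ = 0`. -/
theorem borel_argument_forces_gamma_zero (n : ℕ) (hn : 2 ≤ n)
    (ω α₁ α₂ : ℂ) (hω : ω ≠ 0) (hα₁ : α₁ ≠ 0) (hα₂ : α₂ ≠ 0) (hα : α₁ ≠ α₂)
    (hr₁ : α₁ ≠ (n : ℂ) * α₂) (hr₂ : α₂ ≠ (n : ℂ) * α₁)
    (γ₁ γ₂ m₁ m₂ : ℂ)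
    (heq : ∀ z : ℂ,
      (γ₁ * Complex.exp (α₁ * z) + γ₂ * Complex.exp (α₂ * z)) ^ n
        + ω * (γ₁ * Complex.exp (α₁ * z) + γ₂ * Complex.exp (α₂ * z)) ^ (n - 1)
          * (α₁ * γ₁ * Complex.exp (α₁ * z) + α₂ * γ₂ * Complex.exp (α₂ * z))
        = m₁ * Complex.exp (α₁ * z) + m₂ * Complex.exp (α₂ * z)) :
    γ₁ = 0 ∨ γ₂ = 0 := by
  rcases eq_zero_or_one_add_mul_eq_zero hn hα₁ hα hr₂ heq with h | h₁
  · exact .inl h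
  have heq' := fun z => heq z
  simp only [add_comm (_ * Complex.exp (α₁ * _))] at heq'
  rcases eq_zero_or_one_add_mul_eq_zero hn hα₂ hα.symm hr₁ heq' with h | h₂
  · exact .inr h
  · exact absurd (mul_left_cancel₀ hω (add_left_cancel (h₁.trans h₂.symm))) hα

end
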